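/- Let F₁ = [F₁,v] and F₂ = [F₂,v] be rooted graphs. For every finite simple graph G and every vertex i of G, the product of rooted counts satisfies the exact combinatorial identity X_{F₁}(G,i) · X_{F₂}(G,i) = Σ_{H ∈ H_{F₁,F₂}} c_H · X_H(G,i). -/

import Mathlib

open MeasureTheory ProbabilityTheory Filter

noncomputable section

/-- A rooted graph: a finite simple graph with a distinguished root vertex. -/
structure RootedGraph : Type 1 where
  (V : Type)
  [fintypeV : Fintype V]
  [decEqV : DecidableEq V]
  (graph : SimpleGraph V)
  [decAdj : DecidableRel graph.Adj]
  (root : V)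

attribute [instance] RootedGraph.fintypeV RootedGraph.decEqV RootedGraph.decAdj

/-- Number of vertices of a rooted graph. -/
def RootedGraph.card (F : RootedGraph) : ℕ := Fintype.card F.V

/-- Number of edges of a rooted graph. -/
def RootedGraph.edges (F : RootedGraph) : ℕ := F.graph.edgeFinset.card

/-- `H` is a copy of `F` rooted at vertex `i`: `i` belongs to `H` and there is a graph
isomorphism from `H` to `F` sending `i` to the root of `F`. -/
def IsRootedCopyAt {W : Type} {G : SimpleGraph W} (F : RootedGraph) (i : W)
    (H : G.Subgraph) : Prop :=
  ∃ hi : i ∈ H.verts, ∃ e : H.coe ≃g F.graph, e ⟨i, hi⟩ = F.root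

/-- `X_F(G,i)`: the number of subgraphs of `G` which are copies of `F` rooted at `i`. -/
def rootedCount {W : Type} (F : RootedGraph) (G : SimpleGraph W) (i : W) : ℕ :=
  Nat.card {H : G.Subgraph // IsRootedCopyAt F i H}

/-- Root-preserving isomorphism of rooted graphs. -/
def RootedIso (F F' : RootedGraph) : Prop :=
  ∃ e : F.graph ≃g F'.graph, e F.root = F'.root

/-- `H` is a possible union shape for `F₁, F₂`: it can be written as the union of a rooted
copy of `F₁` and a rooted copy of `F₂`, both rooted at the root of `H`. -/
def IsUnionShape (F₁ F₂ H : RootedGraph) : Prop :=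
  ∃ (H₁ H₂ : H.graph.Subgraph) (h₁ : H.root ∈ H₁.verts) (h₂ : H.root ∈ H₂.verts),
    H₁ ⊔ H₂ = ⊤ ∧
    (∃ e : H₁.coe ≃g F₁.graph, e ⟨H.root, h₁⟩ = F₁.root) ∧
    (∃ e : H₂.coe ≃g F₂.graph, e ⟨H.root, h₂⟩ = F₂.root)

/-- `c_H`: the number of ordered pairs of rooted subgraphs of `H`, rooted copies of `F₁`
resp. `F₂` at the root of `H`, whose union is all of `H`. -/
def cCoeff (F₁ F₂ H : RootedGraph) : ℕ :=
  Nat.card {p : H.graph.Subgraph × H.graph.Subgraph //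
    ∃ (h₁ : H.root ∈ p.1.verts) (h₂ : H.root ∈ p.2.verts),
      p.1 ⊔ p.2 = ⊤ ∧
      (∃ e : p.1.coe ≃g F₁.graph, e ⟨H.root, h₁⟩ = F₁.root) ∧
      (∃ e : p.2.coe ≃g F₂.graph, e ⟨H.root, h₂⟩ = F₂.root)}

/-- The predicate defining `cCoeff`, for a pair of subgraphs of an arbitrary graph. -/
def PairWith {W : Type} {G : SimpleGraph W} (F₁ F₂ : RootedGraph) (i : W)
    (K : G.Subgraph) (p : G.Subgraph × G.Subgraph) : Prop :=
  IsRootedCopyAt F₁ i p.1 ∧ IsRootedCopyAt F₂ i p.2 ∧ p.1 ⊔ p.2 = K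

theorem cCoeff_eq (F₁ F₂ H : RootedGraph) :
    cCoeff F₁ F₂ H = Nat.card {p : H.graph.Subgraph × H.graph.Subgraph //
      PairWith F₁ F₂ H.root ⊤ p} := by
  unfold cCoeff PairWith IsRootedCopyAt
  refine Nat.card_congr (Equiv.subtypeEquivRight fun p => ?_)
  constructor
  · rintro ⟨h₁, h₂, h, e₁, e₂⟩
    exact ⟨⟨h₁, e₁⟩, ⟨h₂, e₂⟩, h⟩
  · rintro ⟨⟨h₁, e₁⟩, ⟨h₂, e₂⟩, h⟩
    exact ⟨h₁, h₂, h, e₁, e₂⟩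

theorem isUnionShape_iff (F₁ F₂ H : RootedGraph) :
    IsUnionShape F₁ F₂ H ↔ ∃ p, PairWith F₁ F₂ H.root (⊤ : H.graph.Subgraph) p := by
  constructor
  · rintro ⟨H₁, H₂, h₁, h₂, h, e₁, e₂⟩
    exact ⟨(H₁, H₂), ⟨h₁, e₁⟩, ⟨h₂, e₂⟩, h⟩
  · rintro ⟨⟨H₁, H₂⟩, ⟨h₁, e₁⟩, ⟨h₂, e₂⟩, h⟩
    exact ⟨H₁, H₂, h₁, h₂, h, e₁, e₂⟩

theorem exists_hom_of_copy {W : Type} {G : SimpleGraph W} {H : RootedGraph} {i : W}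
    {K : G.Subgraph} (h : IsRootedCopyAt H i K) :
    ∃ f : SimpleGraph.Copy H.graph G, f.toHom H.root = i ∧
      SimpleGraph.Subgraph.map f.toHom ⊤ = K := by
  obtain ⟨hi, e, he⟩ := h
  refine ⟨⟨K.hom.comp e.symm.toHom,
    SimpleGraph.Subgraph.hom_injective.comp e.symm.injective⟩, ?_, ?_⟩
  · have : e.symm H.root = ⟨i, hi⟩ := by rw [← he]; simp
    show K.hom (e.symm H.root) = i
    rw [this]; rfl
  · simp [SimpleGraph.Subgraph.map_comp]

theorem copy_map_iff {V W : Type} {A : SimpleGraph V} {G : SimpleGraph W}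
    (f : SimpleGraph.Copy A G) (F : RootedGraph) (r : V) (S : A.Subgraph) :
    IsRootedCopyAt F (f.toHom r) (S.map f.toHom) ↔ IsRootedCopyAt F r S := by
  constructor
  · rintro ⟨hi, e, he⟩
    have hr : r ∈ S.verts := by
      obtain ⟨x, hx, hxr⟩ := hi
      rwa [← f.injective hxr]
    exact ⟨hr, (f.isoSubgraphMap S).trans e, he⟩
  · rintro ⟨hr, e, he⟩
    refine ⟨⟨r, hr, rfl⟩, (f.isoSubgraphMap S).symm.trans e, ?_⟩
    rw [← he]
    show e ((f.isoSubgraphMap S).symm _) = _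
    congr 1
    rw [RelIso.symm_apply_eq]
    rfl

theorem map_copy_injective {V W : Type} {A : SimpleGraph V} {G : SimpleGraph W}
    (f : SimpleGraph.Copy A G) :
    Function.Injective (SimpleGraph.Subgraph.map f.toHom) := by
  intro S T h
  have hinj : Function.Injective f := f.injective
  ext x y
  · have := congrArg (fun K => f.toHom x ∈ SimpleGraph.Subgraph.verts K) h
    simpa [hinj.eq_iff] using this
  · have := congrArg (fun K => SimpleGraph.Subgraph.Adj K (f.toHom x) (f.toHom y)) h
    simpa [Relation.Map, hinj.eq_iff] using this

theorem exists_map_copy {V W : Type} {A : SimpleGraph V} {G : SimpleGraph W}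
    (f : SimpleGraph.Copy A G) (S : G.Subgraph)
    (hS : S ≤ SimpleGraph.Subgraph.map f.toHom ⊤) :
    ∃ T : A.Subgraph, T.map f.toHom = S := by
  refine ⟨S.comap f.toHom, ?_⟩
  apply le_antisymm
  · rw [SimpleGraph.Subgraph.map_le_iff_le_comap]
  · constructor
    · intro x hx
      obtain ⟨y, -, rfl⟩ := hS.1 hx
      exact ⟨y, hx, rfl⟩
    · intro x y hxy
      obtain ⟨a, b, hab, rfl, rfl⟩ := hS.2 hxy
      exact ⟨a, b, ⟨hab, hxy⟩, rfl, rfl⟩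

theorem pairWith_map_bijective {W : Type} {G : SimpleGraph W} (F₁ F₂ : RootedGraph)
    {H : RootedGraph} {i : W} {K : G.Subgraph} (h : IsRootedCopyAt H i K) :
    Nonempty ({p : H.graph.Subgraph × H.graph.Subgraph // PairWith F₁ F₂ H.root ⊤ p} ≃
      {p : G.Subgraph × G.Subgraph // PairWith F₁ F₂ i K p}) := by
  obtain ⟨f, rfl, rfl⟩ := exists_hom_of_copy h
  have key : ∀ p : H.graph.Subgraph × H.graph.Subgraph,
      PairWith F₁ F₂ (f.toHom H.root) (SimpleGraph.Subgraph.map f.toHom ⊤)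
        (p.1.map f.toHom, p.2.map f.toHom) ↔ PairWith F₁ F₂ H.root ⊤ p := by
    intro p
    unfold PairWith
    rw [copy_map_iff, copy_map_iff, ← SimpleGraph.Subgraph.map_sup,
      (map_copy_injective f).eq_iff]
  refine ⟨Equiv.ofBijective (fun p => ⟨_, (key p.1).2 p.2⟩) ⟨?_, ?_⟩⟩
  · rintro ⟨⟨a, b⟩, hp⟩ ⟨⟨c, d⟩, hq⟩ hpq
    simp only [Subtype.mk.injEq, Prod.mk.injEq, (map_copy_injective f).eq_iff] at hpq
    simp [hpq.1, hpq.2]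
  · rintro ⟨⟨a, b⟩, hp⟩
    obtain ⟨c, rfl⟩ := exists_map_copy f a (by rw [← hp.2.2]; exact le_sup_left)
    obtain ⟨d, rfl⟩ := exists_map_copy f b (by rw [← hp.2.2]; exact le_sup_right)
    exact ⟨⟨(c, d), (key (c, d)).1 hp⟩, rfl⟩

theorem rooted_count_product {W : Type} [Fintype W] (F₁ F₂ : RootedGraph)
    (G : SimpleGraph W) (i : W)
    (ι : Type) [Fintype ι] (𝓗 : ι → RootedGraph)
    (h_shapes : ∀ t : ι, IsUnionShape F₁ F₂ (𝓗 t))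
    (h_rep : ∀ H : RootedGraph, IsUnionShape F₁ F₂ H → ∃! t : ι, RootedIso H (𝓗 t)) :
    rootedCount F₁ G i * rootedCount F₂ G i =
      ∑ t : ι, cCoeff F₁ F₂ (𝓗 t) * rootedCount (𝓗 t) G i := by
  classical
  haveI : Finite G.Subgraph := inferInstance
  have hc : ∀ t, cCoeff F₁ F₂ (𝓗 t) * rootedCount (𝓗 t) G i =
      Nat.card (Σ K : {K : G.Subgraph // IsRootedCopyAt (𝓗 t) i K},
        {p : G.Subgraph × G.Subgraph // PairWith F₁ F₂ i K.1 p}) := by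
    intro t
    rw [cCoeff_eq, rootedCount, mul_comm, ← Nat.card_prod]
    refine Nat.card_congr ((Equiv.sigmaEquivProd _ _).symm.trans
      (Equiv.sigmaCongrRight fun K => (pairWith_map_bijective F₁ F₂ K.2).some))
  simp_rw [hc]
  rw [← Nat.card_sigma, rootedCount, rootedCount, ← Nat.card_prod]
  symm
  refine Nat.card_congr (Equiv.ofBijective
    (fun x => (⟨x.2.2.1.1, x.2.2.2.1⟩, ⟨x.2.2.1.2, x.2.2.2.2.1⟩)) ⟨?_, ?_⟩)
  · rintro ⟨t, ⟨K, hK⟩, ⟨⟨a, b⟩, ha, hb, hab⟩⟩ ⟨t', ⟨K', hK'⟩, ⟨⟨a', b'⟩, ha', hb', hab'⟩⟩ h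
    simp only [Prod.mk.injEq, Subtype.mk.injEq] at h
    obtain ⟨rfl, rfl⟩ := h
    dsimp only at hab hab'
    subst hab
    subst hab'
    have : t = t' := by
      refine (h_rep (𝓗 t) (h_shapes t)).unique ⟨SimpleGraph.Iso.refl, rfl⟩ ?_
      obtain ⟨hi, e, he⟩ := hK
      obtain ⟨hi', e', he'⟩ := hK'
      refine ⟨e.symm.trans e', ?_⟩
      show e' (e.symm _) = _
      rw [← he, RelIso.symm_apply_apply, he']
    subst this
    rfl
  · rintro ⟨⟨a, ha⟩, ⟨b, hb⟩⟩
    have hi : i ∈ (a ⊔ b).verts := Or.inl ha.1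
    let H : RootedGraph :=
      { V := (a ⊔ b).verts
        fintypeV := Fintype.ofFinite _
        decEqV := Classical.decEq _
        graph := (a ⊔ b).coe
        decAdj := Classical.decRel _
        root := ⟨i, hi⟩ }
    have hH : IsRootedCopyAt H i (a ⊔ b) := ⟨hi, SimpleGraph.Iso.refl, rfl⟩
    have hU : IsUnionShape F₁ F₂ H := by
      rw [isUnionShape_iff]
      have q := (pairWith_map_bijective F₁ F₂ hH).some.symm ⟨(a, b), ha, hb, rfl⟩
      exact ⟨q.1, q.2⟩
    obtain ⟨t, ⟨e, he⟩, -⟩ := h_rep H hU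
    exact ⟨⟨t, ⟨a ⊔ b, hi, e, he⟩, ⟨(a, b), ha, hb, rfl⟩⟩, rfl⟩
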